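/- The set B = {φ₁+2φ₂+2φ₃, φ₁+φ₂+2φ₃+φ₄, −(φ₁+φ₂+2φ₃), −(φ₁+φ₂+φ₃+φ₄)} is a base of Δ, and the positive system determined by B equals Δ_k⁺ ∪ {β ∈ Δ_n⁺ : β ≥ φ₁+2φ₂+2φ₃ or β ≥ φ₁+φ₂+2φ₃+φ₄} ∪ (−{β ∈ Δ_n⁺ : β ≤ φ₁+φ₂+2φ₃ or β ≤ φ₁+φ₂+φ₃+φ₄}); in particular this positive system contains Δ_k⁺. -/

import Mathlib

noncomputable section

abbrev V : Type := Fin 4 → ℝ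

def e (i : Fin 4) : V := Pi.single i 1

/-- The root system of type F₄ in ℝ⁴ (48 vectors). -/
def Δ : Set V :=
  (⋃ i, ({e i, -e i} : Set V)) ∪
  (⋃ (i) (j) (_ : i < j), ({e i + e j, e i - e j, -e i + e j, -e i - e j} : Set V)) ∪
  {v | ∃ s : Fin 4 → ℝ, (∀ i, s i = 1 ∨ s i = -1) ∧ v = (1 / 2 : ℝ) • ∑ i, s i • e i}

def φ₁ : V := e 1 - e 2
def φ₂ : V := e 2 - e 3
def φ₃ : V := e 3
def φ₄ : V := (1 / 2 : ℝ) • (e 0 - e 1 - e 2 - e 3)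

def φv : Fin 4 → V := ![φ₁, φ₂, φ₃, φ₄]

/-- The coordinates `n₁(α), …, n₄(α)` of `α` with respect to the basis φ₁,…,φ₄:
for every `α : V` one has `α = ∑ i, n α i • φv i`. -/
def n (α : V) : Fin 4 → ℝ :=
  ![α 1 + α 0, α 1 + α 2 + 2 * α 0, α 1 + α 2 + α 3 + 3 * α 0, 2 * α 0]

/-- The highest root δ = 2φ₁+3φ₂+4φ₃+2φ₄ = e₁+e₂. -/
def δ : V := e 0 + e 1

/-- Compact roots: roots α with n₁(α) even. -/
def Δk : Set V := {α ∈ Δ | ∃ m : ℤ, n α 0 = 2 * m}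

/-- Noncompact roots: roots α with n₁(α) odd. -/
def Δn : Set V := {α ∈ Δ | ∃ m : ℤ, n α 0 = 2 * m + 1}

/-- Δ⁺: roots with all φ-coefficients nonnegative. -/
def Δp : Set V := {α ∈ Δ | ∀ i, 0 ≤ n α i}

def Δkp : Set V := Δp ∩ Δk
def Δnp : Set V := Δp ∩ Δn

/-- A positive system of Δ: the set of roots on which some root-regular linear
functional is positive. -/
def IsPosSystem (P : Set V) : Prop :=
  ∃ f : V →ₗ[ℝ] ℝ, (∀ α ∈ Δ, f α ≠ 0) ∧ P = {α ∈ Δ | 0 < f α}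

/-- `le' γ β` means γ ≤ β, i.e. β − γ is a nonnegative integer combination of φ₁,…,φ₄. -/
def le' (γ β : V) : Prop := ∃ c : Fin 4 → ℕ, β - γ = ∑ i, (c i : ℝ) • φv i

/-- A base of Δ: a linearly independent subset of Δ such that every root is an
integral combination with coefficients all ≥ 0 or all ≤ 0. -/
def IsBase (B : Finset V) : Prop :=
  ↑B ⊆ Δ ∧ LinearIndependent ℝ (Subtype.val : {x : V // x ∈ B} → V) ∧
  ∀ α ∈ Δ, ∃ c : V → ℤ,
    α = ∑ x ∈ B, (c x : ℝ) • x ∧ ((∀ x ∈ B, 0 ≤ c x) ∨ (∀ x ∈ B, c x ≤ 0))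

/-- The positive system determined by a base B: roots whose B-coefficients are all ≥ 0. -/
def posOf (B : Finset V) : Set V :=
  {α ∈ Δ | ∃ c : V → ℤ, α = ∑ x ∈ B, (c x : ℝ) • x ∧ ∀ x ∈ B, 0 ≤ c x}

/-- The lattice vector with coordinates `a` in the simple roots `φ₁, …, φ₄`. -/
def ofCoord (a : Fin 4 → ℤ) : V := ∑ i, (a i : ℝ) • φv i

/-- The positive roots in simple-root coordinates. -/
def posRootCoords : List (Fin 4 → ℤ) :=
  [![1,0,0,0], ![0,1,0,0], ![0,0,1,0], ![0,0,0,1], ![1,1,0,0], ![0,1,1,0], ![0,0,1,1],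
   ![1,1,1,0], ![0,1,2,0], ![0,1,1,1], ![1,1,2,0], ![1,1,1,1], ![0,1,2,1], ![1,2,2,0],
   ![1,1,2,1], ![0,1,2,2], ![1,2,2,1], ![1,1,2,2], ![1,2,3,1], ![1,2,2,2], ![1,2,3,2],
   ![1,2,4,2], ![1,3,4,2], ![2,3,4,2]]

def rootCoords : List (Fin 4 → ℤ) := posRootCoords ++ posRootCoords.map Neg.neg

lemma n_ofCoord (a : Fin 4 → ℤ) (i : Fin 4) : n (ofCoord a) i = a i := by
  fin_cases i <;>
    simp [n, ofCoord, φv, Fin.sum_univ_four, φ₁, φ₂, φ₃, φ₄, e] <;> ring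

lemma n_sum (c : Fin 4 → ℝ) (v : Fin 4 → V) (i : Fin 4) :
    n (∑ k, c k • v k) i = ∑ k, c k * n (v k) i := by
  fin_cases i <;> simp [n, Fin.sum_univ_four] <;> ring

lemma ofCoord_injective : Function.Injective ofCoord := fun a b h ↦ by
  ext i
  have := congrArg (fun v ↦ n v i) h
  simpa only [n_ofCoord, Int.cast_inj] using this

lemma ofCoord_neg (a : Fin 4 → ℤ) : ofCoord (-a) = -ofCoord a := by
  simp [ofCoord, Finset.sum_neg_distrib]

lemma ofCoord_sub (a b : Fin 4 → ℤ) : ofCoord (a - b) = ofCoord a - ofCoord b := by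
  simp [ofCoord, sub_smul]

lemma ofCoord_sum (c : Fin 4 → ℤ) (b : Fin 4 → Fin 4 → ℤ) :
    ofCoord (∑ k, c k • b k) = ∑ k, (c k : ℝ) • ofCoord (b k) := by
  simp only [ofCoord, Finset.sum_apply, Pi.smul_apply, smul_eq_mul, Int.cast_sum, Int.cast_mul,
    Finset.sum_smul, Finset.smul_sum, smul_smul]
  exact Finset.sum_comm

lemma le'_ofCoord {a b : Fin 4 → ℤ} : le' (ofCoord a) (ofCoord b) ↔ ∀ i, a i ≤ b i := by
  constructor
  · rintro ⟨c, hc⟩ i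
    have h : b - a = fun i ↦ (c i : ℤ) := ofCoord_injective <| by
      rw [ofCoord_sub, hc]
      simp [ofCoord]
    have := congrFun h i
    simp only [Pi.sub_apply] at this
    omega
  · intro h
    refine ⟨fun i ↦ (b i - a i).toNat, ?_⟩
    rw [← ofCoord_sub]
    refine Finset.sum_congr rfl fun i _ ↦ ?_
    congr 1
    exact_mod_cast (Int.toNat_of_nonneg (sub_nonneg.2 (h i))).symm

/-- Simple-root coordinates of the standard basis vectors. -/
def stdCoord : Fin 4 → Fin 4 → ℤ := ![![1,2,3,2], ![1,1,1,0], ![0,1,1,0], ![0,0,1,0]]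

lemma ofCoord_eq_iff {a : Fin 4 → ℤ} {v : V} : ofCoord a = v ↔
    (a 3 : ℝ) = 2 * v 0 ∧ (2 * a 0 - a 3 : ℝ) = 2 * v 1 ∧ (2 * (a 1 - a 0) - a 3 : ℝ) = 2 * v 2 ∧
      (2 * (a 2 - a 1) - a 3 : ℝ) = 2 * v 3 := by
  rw [funext_iff, Fin.forall_fin_succ, Fin.forall_fin_succ, Fin.forall_fin_succ,
    Fin.forall_fin_one]
  simp [ofCoord, φv, Fin.sum_univ_four, φ₁, φ₂, φ₃, φ₄, e]
  refine ⟨fun ⟨h0, h1, h2, h3⟩ ↦ ?_, fun ⟨h0, h1, h2, h3⟩ ↦ ?_⟩ <;>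
    refine ⟨?_, ?_, ?_, ?_⟩ <;> linarith

lemma ofCoord_stdCoord (i : Fin 4) : ofCoord (stdCoord i) = e i := by
  rw [ofCoord_eq_iff]
  fin_cases i <;> simp [stdCoord, e]
  all_goals norm_num

lemma ofCoord_add (a b : Fin 4 → ℤ) : ofCoord (a + b) = ofCoord a + ofCoord b := by
  rw [← sub_neg_eq_add, ofCoord_sub, ofCoord_neg, sub_neg_eq_add]

lemma exists_rootCoords_of_mem {α : V} (h : α ∈ Δ) : ∃ a ∈ rootCoords, ofCoord a = α := by
  rcases h with (h | h) | ⟨s, hs, rfl⟩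
  · obtain ⟨i, h⟩ := Set.mem_iUnion.1 h
    have H : ∀ i, stdCoord i ∈ rootCoords ∧ -stdCoord i ∈ rootCoords := by decide
    rcases h with rfl | rfl
    · exact ⟨_, (H i).1, ofCoord_stdCoord i⟩
    · exact ⟨_, (H i).2, by rw [ofCoord_neg, ofCoord_stdCoord]⟩
  · simp only [Set.mem_iUnion] at h
    obtain ⟨i, j, hij, h⟩ := h
    have H : ∀ i j, i < j → stdCoord i + stdCoord j ∈ rootCoords ∧
        stdCoord i - stdCoord j ∈ rootCoords ∧ -stdCoord i + stdCoord j ∈ rootCoords ∧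
        -stdCoord i - stdCoord j ∈ rootCoords := by decide
    obtain ⟨h1, h2, h3, h4⟩ := H i j hij
    rcases h with rfl | rfl | rfl | rfl
    · exact ⟨_, h1, by simp only [ofCoord_add, ofCoord_stdCoord]⟩
    · exact ⟨_, h2, by simp only [ofCoord_sub, ofCoord_stdCoord]⟩
    · exact ⟨_, h3, by simp only [ofCoord_add, ofCoord_neg, ofCoord_stdCoord]⟩
    · exact ⟨_, h4, by simp only [ofCoord_sub, ofCoord_neg, ofCoord_stdCoord]⟩
  · have H : ∀ t : Fin 4 → Bool, ∃ a ∈ rootCoords,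
        a + a = ∑ i, (if t i then 1 else -1 : ℤ) • stdCoord i := by decide
    obtain ⟨a, ha, h⟩ := H fun i ↦ decide (s i = 1)
    refine ⟨a, ha, ?_⟩
    have h2 : ofCoord a + ofCoord a = ∑ i, s i • e i := by
      rw [← ofCoord_add, h, ofCoord_sum]
      refine Finset.sum_congr rfl fun i _ ↦ ?_
      rw [ofCoord_stdCoord]
      rcases hs i with hi | hi <;> norm_num [hi]
    rw [← h2, ← two_smul ℝ, smul_smul]
    norm_num

lemma neg_mem_Δ {α : V} (h : α ∈ Δ) : -α ∈ Δ := by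
  rcases h with (h | h) | ⟨s, hs, rfl⟩
  · obtain ⟨i, h⟩ := Set.mem_iUnion.1 h
    refine .inl (.inl (Set.mem_iUnion.2 ⟨i, ?_⟩))
    rcases h with rfl | rfl <;> simp
  · simp only [Set.mem_iUnion] at h
    obtain ⟨i, j, hij, h⟩ := h
    refine .inl (.inr ?_)
    simp only [Set.mem_iUnion]
    refine ⟨i, j, hij, ?_⟩
    rcases h with rfl | rfl | rfl | rfl
    · exact .inr (.inr (.inr (by simp; abel)))
    · exact .inr (.inr (.inl (by abel)))
    · exact .inr (.inl (by abel))
    · exact .inl (by abel)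
  · refine .inr ⟨-s, fun i ↦ ?_, by simp⟩
    rcases hs i with h | h <;> simp [h]

lemma ofCoord_mem_Δkp {a : Fin 4 → ℤ} (h : ofCoord a ∈ Δ) :
    ofCoord a ∈ Δkp ↔ (∀ i, 0 ≤ a i) ∧ a 0 % 2 = 0 := by
  simp only [Δkp, Δp, Δk, Set.mem_inter_iff, Set.mem_ofPred_eq, h, true_and, n_ofCoord]
  norm_cast
  exact and_congr_right fun _ ↦ ⟨by rintro ⟨m, hm⟩; omega, fun h ↦ ⟨a 0 / 2, by omega⟩⟩

lemma ofCoord_mem_Δnp {a : Fin 4 → ℤ} (h : ofCoord a ∈ Δ) :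
    ofCoord a ∈ Δnp ↔ (∀ i, 0 ≤ a i) ∧ a 0 % 2 = 1 := by
  simp only [Δnp, Δp, Δn, Set.mem_inter_iff, Set.mem_ofPred_eq, h, true_and, n_ofCoord]
  norm_cast
  exact and_congr_right fun _ ↦ ⟨by rintro ⟨m, hm⟩; omega, fun h ↦ ⟨a 0 / 2, by omega⟩⟩

/-- Simple-root coordinates of the four elements of the base `B`. -/
def baseCoord : Fin 4 → Fin 4 → ℤ :=
  ![![1,2,2,0], ![1,1,2,1], -![1,1,2,0], -![1,1,1,1]]

/-- Coordinates in the base `B` of the vector with simple-root coordinates `a`. -/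
def coeffB (a : Fin 4 → ℤ) : Fin 4 → ℤ :=
  ![a 1 - a 0, a 2 + a 3 - 2 * a 0, a 1 + a 3 - 2 * a 0, a 2 - 2 * a 0]

lemma sum_coeffB (a : Fin 4 → ℤ) : ∑ k, coeffB a k • baseCoord k = a := by
  ext i
  fin_cases i <;> simp [Fin.sum_univ_four, coeffB, baseCoord] <;> ring

lemma linearIndependent_baseCoord :
    LinearIndependent ℝ fun k ↦ ofCoord (baseCoord k) := by
  rw [Fintype.linearIndependent_iff]
  intro g hg
  have h i : ∑ k, g k * (baseCoord k i : ℝ) = 0 := by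
    rw [← (by fin_cases i <;> simp [n] : n 0 i = 0), ← hg, n_sum]
    simp only [n_ofCoord]
  have h0 := h 0
  have h1 := h 1
  have h2 := h 2
  have h3 := h 3
  simp [Fin.sum_univ_four, baseCoord] at h0 h1 h2 h3
  have g0 : g 0 = 0 := by linarith
  have g1 : g 1 = 0 := by linarith
  have g2 : g 2 = 0 := by linarith
  have g3 : g 3 = 0 := by linarith
  intro k
  fin_cases k <;> assumption

/-- The base `B`, as the image of the vectors `baseCoord`. -/
def baseB : Finset V :=
  Finset.univ.map ⟨_, linearIndependent_baseCoord.injective⟩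

lemma sum_baseB (c : V → ℤ) : ∑ x ∈ baseB, (c x : ℝ) • x =
    ofCoord (∑ k, c (ofCoord (baseCoord k)) • baseCoord k) := by
  rw [baseB, Finset.sum_map, ofCoord_sum]
  rfl

lemma forall_mem_baseB {p : V → Prop} :
    (∀ x ∈ baseB, p x) ↔ ∀ k, p (ofCoord (baseCoord k)) := by
  simp [baseB]

lemma coeffB_sum (c : Fin 4 → ℤ) : coeffB (∑ k, c k • baseCoord k) = c := by
  ext i
  fin_cases i <;> simp [Fin.sum_univ_four, coeffB, baseCoord] <;> ring

lemma exists_coeff_baseB (a : Fin 4 → ℤ) : ∃ c : V → ℤ,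
    ofCoord a = ∑ x ∈ baseB, (c x : ℝ) • x ∧ ∀ k, c (ofCoord (baseCoord k)) = coeffB a k := by
  have h k : Function.extend (fun k ↦ ofCoord (baseCoord k)) (coeffB a) 0
      (ofCoord (baseCoord k)) = coeffB a k :=
    linearIndependent_baseCoord.injective.extend_apply _ _ k
  refine ⟨_, ?_, h⟩
  simp only [sum_baseB, h, sum_coeffB]

lemma ofCoord_mem_posOf {a : Fin 4 → ℤ} (h : ofCoord a ∈ Δ) :
    ofCoord a ∈ posOf baseB ↔ ∀ k, 0 ≤ coeffB a k := by
  simp only [posOf, Set.mem_ofPred_eq, h, true_and, forall_mem_baseB]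
  constructor
  · rintro ⟨c, hc, hpos⟩
    rw [sum_baseB] at hc
    rw [ofCoord_injective hc, coeffB_sum fun k ↦ c (ofCoord (baseCoord k))]
    exact hpos
  · intro hpos
    obtain ⟨c, hc, hk⟩ := exists_coeff_baseB a
    exact ⟨c, hc, fun k ↦ hk k ▸ hpos k⟩

lemma mem_Δ_of_lt {i j : Fin 4} (h : i < j) : e i + e j ∈ Δ := by
  refine .inl (.inr ?_)
  simp only [Set.mem_iUnion]
  exact ⟨i, j, h, .inl rfl⟩

lemma baseB_subset : ↑baseB ⊆ Δ := by
  have H : ∀ x ∈ baseB, x ∈ Δ := by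
    rw [forall_mem_baseB]
    have hs (s : Fin 4 → ℝ) (hs : ∀ i, s i = 1 ∨ s i = -1) :
        (1 / 2 : ℝ) • ∑ i, s i • e i ∈ Δ := .inr ⟨s, hs, rfl⟩
    have h0 : ofCoord ![1,2,2,0] = e 1 + e 2 := by
      simp only [← ofCoord_stdCoord, ← ofCoord_add]
      exact congrArg _ (by decide)
    have h1 : ofCoord ![1,1,2,1] = (1 / 2 : ℝ) • ∑ i, (![1,1,-1,1] : Fin 4 → ℝ) i • e i := by
      rw [ofCoord_eq_iff]
      simp [Fin.sum_univ_four, e]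
      norm_num
    have h2 : ofCoord ![1,1,2,0] = e 1 + e 3 := by
      simp only [← ofCoord_stdCoord, ← ofCoord_add]
      exact congrArg _ (by decide)
    have h3 : ofCoord ![1,1,1,1] = (1 / 2 : ℝ) • ∑ i, (![1,1,-1,-1] : Fin 4 → ℝ) i • e i := by
      rw [ofCoord_eq_iff]
      simp [Fin.sum_univ_four, e]
      norm_num
    intro k
    fin_cases k
    · exact h0 ▸ mem_Δ_of_lt (by decide)
    · exact h1 ▸ hs _ (by simp [Fin.forall_fin_succ])
    · exact ofCoord_neg _ ▸ neg_mem_Δ (h2 ▸ mem_Δ_of_lt (by decide))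
    · exact ofCoord_neg _ ▸ neg_mem_Δ (h3 ▸ hs _ (by simp [Fin.forall_fin_succ]))
  exact H

lemma isBase_baseB : IsBase baseB := by
  refine ⟨baseB_subset, ?_, fun α hα ↦ ?_⟩
  · have h := linearIndependent_baseCoord.linearIndepOn_id
    have hB : Set.range (fun k ↦ ofCoord (baseCoord k)) = ↑baseB := by simp [baseB]
    rw [hB] at h
    exact h
  · obtain ⟨a, ha, rfl⟩ := exists_rootCoords_of_mem hα
    obtain ⟨c, hc, hk⟩ := exists_coeff_baseB a
    refine ⟨c, hc, ?_⟩
    simp only [forall_mem_baseB, hk]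
    have H : ∀ a ∈ rootCoords, (∀ k, 0 ≤ coeffB a k) ∨ ∀ k, coeffB a k ≤ 0 := by decide
    exact H a ha


theorem stmt12 :
    IsBase ({φ₁ + (2 : ℝ) • φ₂ + (2 : ℝ) • φ₃, φ₁ + φ₂ + (2 : ℝ) • φ₃ + φ₄, -(φ₁ + φ₂ + (2 : ℝ) • φ₃), -(φ₁ + φ₂ + φ₃ + φ₄)} : Finset V) ∧
    posOf ({φ₁ + (2 : ℝ) • φ₂ + (2 : ℝ) • φ₃, φ₁ + φ₂ + (2 : ℝ) • φ₃ + φ₄, -(φ₁ + φ₂ + (2 : ℝ) • φ₃), -(φ₁ + φ₂ + φ₃ + φ₄)} : Finset V) =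
      Δkp ∪ {β ∈ Δnp | le' (φ₁ + (2 : ℝ) • φ₂ + (2 : ℝ) • φ₃) β ∨ le' (φ₁ + φ₂ + (2 : ℝ) • φ₃ + φ₄) β} ∪ (Neg.neg '' {β ∈ Δnp | le' β (φ₁ + φ₂ + (2 : ℝ) • φ₃) ∨ le' β (φ₁ + φ₂ + φ₃ + φ₄)}) ∧
    Δkp ⊆ posOf ({φ₁ + (2 : ℝ) • φ₂ + (2 : ℝ) • φ₃, φ₁ + φ₂ + (2 : ℝ) • φ₃ + φ₄, -(φ₁ + φ₂ + (2 : ℝ) • φ₃), -(φ₁ + φ₂ + φ₃ + φ₄)} : Finset V) := by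
  have e1 : φ₁ + (2 : ℝ) • φ₂ + (2 : ℝ) • φ₃ = ofCoord ![1,2,2,0] := by
    simp [ofCoord, φv, Fin.sum_univ_four]
  have e2 : φ₁ + φ₂ + (2 : ℝ) • φ₃ + φ₄ = ofCoord ![1,1,2,1] := by
    simp [ofCoord, φv, Fin.sum_univ_four]
  have e3 : φ₁ + φ₂ + (2 : ℝ) • φ₃ = ofCoord ![1,1,2,0] := by
    simp [ofCoord, φv, Fin.sum_univ_four]
  have e4 : φ₁ + φ₂ + φ₃ + φ₄ = ofCoord ![1,1,1,1] := by
    simp [ofCoord, φv, Fin.sum_univ_four]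
  have hB : ({ofCoord ![1,2,2,0], ofCoord ![1,1,2,1], -ofCoord ![1,1,2,0],
      -ofCoord ![1,1,1,1]} : Finset V) = baseB := by
    ext x
    simp [baseB, Fin.exists_fin_succ, baseCoord, ← ofCoord_neg, eq_comm]
  rw [e2, e1, e3, e4, hB]
  have key : posOf baseB = Δkp ∪
      {β ∈ Δnp | le' (ofCoord ![1,2,2,0]) β ∨ le' (ofCoord ![1,1,2,1]) β} ∪
      (Neg.neg '' {β ∈ Δnp | le' β (ofCoord ![1,1,2,0]) ∨ le' β (ofCoord ![1,1,1,1])}) := by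
    ext α
    by_cases hα : α ∈ Δ
    · obtain ⟨a, ha, rfl⟩ := exists_rootCoords_of_mem hα
      have hα' : ofCoord (-a) ∈ Δ := ofCoord_neg a ▸ neg_mem_Δ hα
      rw [Set.image_neg_eq_neg, ofCoord_mem_posOf hα]
      simp only [Set.mem_union, Set.mem_neg, Set.mem_ofPred_eq, ← ofCoord_neg, le'_ofCoord,
        ofCoord_mem_Δkp hα, ofCoord_mem_Δnp hα, ofCoord_mem_Δnp hα']
      clear hα hα'
      revert a
      decide
    · refine iff_of_false (fun h ↦ hα h.1) ?_
      rintro ((h | h) | ⟨β, h, rfl⟩)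
      · exact hα h.1.1
      · exact hα h.1.1.1
      · exact hα (neg_mem_Δ h.1.1.1)
  refine ⟨isBase_baseB, key, ?_⟩
  rw [key]
  exact fun _ h ↦ .inl (.inl h)
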